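/- Let 0 < α < n, let Φ be an Orlicz function and 0 ≤ λ < 1. Then there exists a constant C₃ > 0 (one may take C₃ = 2^{n+1} v_n^{1−α/n} / (n ln 2)) such that for every f ∈ M^{Φ,λ}(0) and every r > 0, ∫_{ℝⁿ∖B_r} |f(y)| |y|^{α−n} dy ≤ C₃ ‖f‖_{M^{Φ,λ}(0)} ∫_{|B_r|}^{∞} t^{α/n} Φ⁻¹(t^{λ−1}) dt/t. -/

import Mathlib

open MeasureTheory Metric Set Filter ENNReal NNReal Topology

noncomputable section

/-- ℝⁿ as Euclidean space. -/
abbrev Eu (n : ℕ) : Type := EuclideanSpace ℝ (Fin n)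

/-- The (right-continuous) generalized inverse `Φ⁻¹(v) = inf {u ≥ 0 : Φ(u) > v}`
(with `inf ∅ = ∞`). -/
def yInv (Φ : ℝ≥0∞ → ℝ≥0∞) (v : ℝ≥0∞) : ℝ≥0∞ := sInf {u : ℝ≥0∞ | v < Φ u}

/-- The complementary (conjugate) function `Φ*(v) = sup_{u > 0} (u⬝v − Φ(u))`. -/
def yConj (Φ : ℝ≥0∞ → ℝ≥0∞) (v : ℝ≥0∞) : ℝ≥0∞ :=
  ⨆ (u : ℝ≥0∞) (_ : 0 < u) (_ : u ≠ ∞), u * v - Φ u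

/-- The dilation function `s_{Φ⁻¹}(t) = sup_{s > 0} Φ⁻¹(st)/Φ⁻¹(s)`. -/
def sDil (Φ : ℝ≥0∞ → ℝ≥0∞) (t : ℝ≥0∞) : ℝ≥0∞ :=
  ⨆ (s : ℝ≥0∞) (_ : 0 < s) (_ : s ≠ ∞), yInv Φ (s * t) / yInv Φ s

/-- A Young function: nondecreasing, convex, `Φ(0) = 0 = lim_{u→0+} Φ(u)`, not identically
`0` nor `∞` on `(0,∞)`, and left continuous (values in `[0,∞]`, the value at `∞` being the
canonical/limit extension). -/
structure IsYoungFn (Φ : ℝ≥0∞ → ℝ≥0∞) : Prop where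
  mono : Monotone Φ
  map_zero : Φ 0 = 0
  tendsto_zero : Filter.Tendsto Φ (nhdsWithin 0 (Set.Ioi 0)) (nhds 0)
  convex : ∀ a b t : ℝ≥0∞, t ≤ 1 → Φ (t * a + (1 - t) * b) ≤ t * Φ a + (1 - t) * Φ b
  not_zero : ∃ u : ℝ≥0∞, 0 < u ∧ u ≠ ∞ ∧ Φ u ≠ 0
  not_top : ∃ u : ℝ≥0∞, 0 < u ∧ u ≠ ∞ ∧ Φ u ≠ ∞
  left_cont : ∀ u : ℝ≥0∞, 0 < u → Filter.Tendsto Φ (nhdsWithin u (Set.Iio u)) (nhds (Φ u))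

/-- An Orlicz function: increasing, continuous, convex, `Φ(0) = 0`, finite on `[0,∞)`
(the value at `∞` being the canonical extension `Φ(∞) = ∞`). -/
structure IsOrliczFn (Φ : ℝ≥0∞ → ℝ≥0∞) : Prop where
  map_zero : Φ 0 = 0
  strictMono : StrictMono Φ
  continuous : Continuous Φ
  convex : ∀ a b t : ℝ≥0∞, t ≤ 1 → Φ (t * a + (1 - t) * b) ≤ t * Φ a + (1 - t) * Φ b
  finite : ∀ u : ℝ≥0∞, u ≠ ∞ → Φ u ≠ ∞
  map_top : Φ ∞ = ∞

/-- The Δ₂-condition: `0 < Φ(u) < ∞` for `0 < u < ∞` and `Φ(2u) ≤ D₂ Φ(u)` for some `D₂ ≥ 1`. -/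
def IsDelta2 (Φ : ℝ≥0∞ → ℝ≥0∞) : Prop :=
  (∀ u : ℝ≥0∞, 0 < u → u ≠ ∞ → 0 < Φ u ∧ Φ u ≠ ∞) ∧
    ∃ D : ℝ≥0∞, 1 ≤ D ∧ D ≠ ∞ ∧ ∀ u : ℝ≥0∞, u ≠ ∞ → Φ (2 * u) ≤ D * Φ u

/-- The Luxemburg-type functional `‖f‖_{Φ,λ,A}`. -/
def orliczNorm {n : ℕ} (Φ : ℝ≥0∞ → ℝ≥0∞) (lam : ℝ) (A : Set (Eu n)) (f : Eu n → ℝ) : ℝ≥0∞ :=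
  sInf {ε : ℝ≥0∞ | 0 < ε ∧ ε ≠ ∞ ∧
    volume A ^ (-lam) * ∫⁻ x in A, Φ ((‖f x‖₊ : ℝ≥0∞) / ε) ≤ 1}

/-- The weak Luxemburg-type functional `‖f‖_{Φ,λ,A,∞}`. -/
def orliczWeakNorm {n : ℕ} (Φ : ℝ≥0∞ → ℝ≥0∞) (lam : ℝ) (A : Set (Eu n)) (f : Eu n → ℝ) : ℝ≥0∞ :=
  sInf {ε : ℝ≥0∞ | 0 < ε ∧ ε ≠ ∞ ∧
    (⨆ (u : ℝ≥0) (_ : 0 < u),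
      Φ ((u : ℝ≥0∞) / ε) * (volume A ^ (-lam) * volume {x ∈ A | u < ‖f x‖₊})) ≤ 1}

/-- The central Morrey–Orlicz norm `‖f‖_{M^{Φ,λ}(0)} = sup_{r>0} ‖f‖_{Φ,λ,B_r}`. -/
def centralNorm {n : ℕ} (Φ : ℝ≥0∞ → ℝ≥0∞) (lam : ℝ) (f : Eu n → ℝ) : ℝ≥0∞ :=
  ⨆ (r : ℝ) (_ : 0 < r), orliczNorm Φ lam (ball (0 : Eu n) r) f

/-- The weak central Morrey–Orlicz norm `‖f‖_{WM^{Φ,λ}(0)} = sup_{r>0} ‖f‖_{Φ,λ,B_r,∞}`. -/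
def centralWeakNorm {n : ℕ} (Φ : ℝ≥0∞ → ℝ≥0∞) (lam : ℝ) (f : Eu n → ℝ) : ℝ≥0∞ :=
  ⨆ (r : ℝ) (_ : 0 < r), orliczWeakNorm Φ lam (ball (0 : Eu n) r) f

/-- The Riesz potential `I_α f(x) = ∫ f(y) |x−y|^{α−n} dy`. -/
def riesz {n : ℕ} (α : ℝ) (f : Eu n → ℝ) (x : Eu n) : ℝ :=
  ∫ y, f y / ‖x - y‖ ^ ((n : ℝ) - α)

/-- The classical Morrey norm `‖f‖_{M^{p,λ}}`. -/
def morreyNormP {n : ℕ} (p lam : ℝ) (f : Eu n → ℝ) : ℝ≥0∞ :=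
  ⨆ (x₀ : Eu n) (r : ℝ) (_ : 0 < r),
    (volume (ball x₀ r) ^ (-lam) * ∫⁻ x in ball x₀ r, (‖f x‖₊ : ℝ≥0∞) ^ p) ^ (1 / p)

/-- The classical central Morrey norm `‖f‖_{M^{p,λ}(0)}`. -/
def centralNormP {n : ℕ} (p lam : ℝ) (f : Eu n → ℝ) : ℝ≥0∞ :=
  ⨆ (r : ℝ) (_ : 0 < r),
    (volume (ball (0 : Eu n) r) ^ (-lam) * ∫⁻ x in ball (0 : Eu n) r, (‖f x‖₊ : ℝ≥0∞) ^ p) ^ (1 / p)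

lemma yInv_mono (Φ : ℝ≥0∞ → ℝ≥0∞) : Monotone (yInv Φ) :=
  fun _ _ h => sInf_le_sInf fun _ hu => h.trans_lt hu

lemma IsOrliczFn.apply_yInv {Φ : ℝ≥0∞ → ℝ≥0∞} (hΦ : IsOrliczFn Φ) {v : ℝ≥0∞} (hv : v ≠ ∞) :
    Φ (yInv Φ v) = v := by
  obtain ⟨a, ha⟩ : ∃ a, Φ a = v :=
    mem_range_of_exists_le_of_exists_ge hΦ.continuous ⟨0, by simp [hΦ.map_zero]⟩
      ⟨∞, by simp [hΦ.map_top]⟩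
  have ha' : a ≠ ∞ := by
    rintro rfl
    exact hv (ha ▸ hΦ.map_top)
  have : yInv Φ v = a := by
    have hset : {u : ℝ≥0∞ | v < Φ u} = Ioi a := by
      ext u
      simp [← ha, hΦ.strictMono.lt_iff_lt]
    rw [yInv, hset]
    refine le_antisymm (le_of_forall_gt fun b hb => ?_) (le_sInf fun b hb => le_of_lt hb)
    obtain ⟨d, h1, h2⟩ := exists_between hb
    exact (sInf_le (show d ∈ Ioi a from h1)).trans_lt h2
  rw [this, ha]

/-- By convexity `Φ(u) / u` is nondecreasing, so `u ≤ a + a Φ(u) / Φ(a)`. -/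
lemma IsOrliczFn.le_add_div_mul {Φ : ℝ≥0∞ → ℝ≥0∞} (hΦ : IsOrliczFn Φ) {a : ℝ≥0∞}
    (ha0 : a ≠ 0) (ha : a ≠ ∞) (u : ℝ≥0∞) : u ≤ a + a / Φ a * Φ u := by
  have hv0 : Φ a ≠ 0 := by
    have := hΦ.strictMono (pos_iff_ne_zero.2 ha0)
    rw [hΦ.map_zero] at this
    exact this.ne'
  have hv : Φ a ≠ ∞ := hΦ.finite a ha
  rcases le_or_gt u a with h | h
  · exact h.trans le_self_add
  refine le_add_left ?_
  rcases eq_or_ne u ∞ with rfl | hu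
  · rw [hΦ.map_top, ENNReal.mul_top (ENNReal.div_pos ha0 hv).ne']
  have hu0 : u ≠ 0 := (pos_of_gt h).ne'
  have key := hΦ.convex u 0 (a / u) (ENNReal.div_le_of_le_mul (by simpa using h.le))
  rw [mul_zero, add_zero, hΦ.map_zero, mul_zero, add_zero, ENNReal.div_mul_cancel hu0 hu] at key
  calc u = u / Φ a * Φ a := (ENNReal.div_mul_cancel hv0 hv).symm
    _ ≤ u / Φ a * (a / u * Φ u) := by gcongr
    _ = (a / u * u) / Φ a * Φ u := by simp only [div_eq_mul_inv]; ring
    _ = a / Φ a * Φ u := by rw [ENNReal.div_mul_cancel hu0 hu]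

lemma lintegral_nnnorm_le_orliczNorm {n : ℕ} {Φ : ℝ≥0∞ → ℝ≥0∞} (hΦ : IsOrliczFn Φ) (lam : ℝ)
    (f : Eu n → ℝ) {A : Set (Eu n)} {V : ℝ} (hV : 0 < V) (hA : volume A = ENNReal.ofReal V) :
    ∫⁻ x in A, (‖f x‖₊ : ℝ≥0∞) ≤ orliczNorm Φ lam A f *
      (2 * ENNReal.ofReal V * yInv Φ (ENNReal.ofReal (V ^ (lam - 1)))) := by
  set v : ℝ≥0∞ := ENNReal.ofReal (V ^ (lam - 1)) with hv
  have hv0 : v ≠ 0 := by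
    rw [hv, Ne, ENNReal.ofReal_eq_zero, not_le]
    positivity
  have hΦa : Φ (yInv Φ v) = v := hΦ.apply_yInv ENNReal.ofReal_ne_top
  set a := yInv Φ v
  have ha0 : a ≠ 0 := fun h => hv0 (by rw [← hΦa, h, hΦ.map_zero])
  have ha : a ≠ ∞ := fun h => ENNReal.ofReal_ne_top (by rw [← hv, ← hΦa, h, hΦ.map_top])
  have hV0 : ENNReal.ofReal V ≠ 0 := by simpa using hV
  have hK0 : 2 * ENNReal.ofReal V * a ≠ 0 := by simp [ha0, hV]
  have hK : 2 * ENNReal.ofReal V * a ≠ ∞ := by finiteness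
  rw [← ENNReal.div_le_iff hK0 hK]
  refine le_sInf ?_
  rintro ε ⟨hε0, hε, hle⟩
  rw [ENNReal.div_le_iff hK0 hK]
  have hpow0 : volume A ^ (-lam) ≠ 0 := by
    rw [hA, ENNReal.ofReal_rpow_of_pos hV, Ne, ENNReal.ofReal_eq_zero, not_le]
    positivity
  have hint : ∫⁻ x in A, Φ ((‖f x‖₊ : ℝ≥0∞) / ε) ≤ v * ENNReal.ofReal V := by
    have hmul : volume A ^ (-lam) * (v * ENNReal.ofReal V) = 1 := by
      rw [hA, hv, ENNReal.ofReal_rpow_of_pos hV, ← ENNReal.ofReal_mul (by positivity),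
        ← ENNReal.ofReal_mul (by positivity), Real.rpow_sub_one hV.ne', Real.rpow_neg hV.le]
      have : V ^ lam ≠ 0 := (Real.rpow_pos_of_pos hV _).ne'
      rw [div_mul_cancel₀ _ hV.ne', inv_mul_cancel₀ this, ENNReal.ofReal_one]
    rw [← hmul] at hle
    have hpow : volume A ^ (-lam) ≠ ∞ := by
      rw [hA, ENNReal.ofReal_rpow_of_pos hV]
      exact ENNReal.ofReal_ne_top
    exact (ENNReal.mul_le_mul_iff_right hpow0 hpow).1 hle
  have hav : a / v ≠ ∞ := ENNReal.div_ne_top ha hv0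
  calc ∫⁻ x in A, (‖f x‖₊ : ℝ≥0∞)
      ≤ ∫⁻ x in A, ε * (a + a / v * Φ ((‖f x‖₊ : ℝ≥0∞) / ε)) := by
        refine lintegral_mono fun x => ?_
        have h := hΦ.le_add_div_mul ha0 ha ((‖f x‖₊ : ℝ≥0∞) / ε)
        rw [hΦa] at h
        calc (‖f x‖₊ : ℝ≥0∞) = ε * (‖f x‖₊ / ε) := (ENNReal.mul_div_cancel hε0.ne' hε).symm
          _ ≤ _ := by gcongr
    _ = ε * (a * ENNReal.ofReal V + a / v * ∫⁻ x in A, Φ ((‖f x‖₊ : ℝ≥0∞) / ε)) := by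
        rw [lintegral_const_mul' _ _ hε, lintegral_add_left measurable_const,
          lintegral_const_mul' _ _ hav, setLIntegral_const, hA]
    _ ≤ ε * (a * ENNReal.ofReal V + a / v * (v * ENNReal.ofReal V)) := by gcongr
    _ = ε * (2 * ENNReal.ofReal V * a) := by
        rw [← mul_assoc (a / v), ENNReal.div_mul_cancel hv0 ENNReal.ofReal_ne_top]
        ring

lemma exists_volume_ball_eq (n : ℕ) : ∃ c : ℝ, 0 < c ∧ ∀ R : ℝ, 0 < R →
    volume (ball (0 : Eu n) R) = ENNReal.ofReal (c * R ^ n) := by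
  refine ⟨(volume (ball (0 : Eu n) 1)).toReal,
    ENNReal.toReal_pos (measure_ball_pos volume _ one_pos).ne' measure_ball_lt_top.ne, ?_⟩
  intro R hR
  rw [Measure.addHaar_ball_of_pos volume _ hR, finrank_euclideanSpace_fin, mul_comm,
    ENNReal.ofReal_mul ENNReal.toReal_nonneg, ENNReal.ofReal_toReal measure_ball_lt_top.ne]

lemma compl_ball_subset_iUnion_annuli {n : ℕ} {r : ℝ} (hr : 0 < r) :
    (ball (0 : Eu n) r)ᶜ ⊆
      ⋃ k : ℕ, ball (0 : Eu n) (2 ^ (k + 1) * r) \ ball 0 (2 ^ k * r) := by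
  intro y hy
  have hy' : r ≤ ‖y‖ := by simpa using hy
  obtain ⟨k, h1, h2⟩ := exists_nat_pow_near ((one_le_div hr).2 hy') (one_lt_two (α := ℝ))
  rw [le_div_iff₀ hr] at h1
  rw [div_lt_iff₀ hr] at h2
  exact mem_iUnion.2 ⟨k, by simpa using h2, by simpa using h1⟩

/-- The radial integrand is bounded below on a shell of volumes by its value at the right end. -/
lemma mul_yInv_le_lintegral_Ioc {Φ : ℝ≥0∞ → ℝ≥0∞} {lam β U V : ℝ} (hβ : β ≤ 1)
    (hlam : lam ≤ 1) (hU : 0 < U) (hUV : 2 * U ≤ V) :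
    ENNReal.ofReal (V ^ β / 2) * yInv Φ (ENNReal.ofReal (V ^ (lam - 1))) ≤
      ∫⁻ s in Ioc U V, ENNReal.ofReal (s ^ β) * yInv Φ (ENNReal.ofReal (s ^ (lam - 1))) /
        ENNReal.ofReal s := by
  have hV : 0 < V := by linarith
  calc ENNReal.ofReal (V ^ β / 2) * yInv Φ (ENNReal.ofReal (V ^ (lam - 1)))
      ≤ ENNReal.ofReal (V ^ (β - 1) * (V - U)) *
          yInv Φ (ENNReal.ofReal (V ^ (lam - 1))) := by
        gcongr
        have h : V ^ β / 2 = V ^ (β - 1) * (V / 2) := by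
          rw [Real.rpow_sub_one hV.ne']
          field_simp
        rw [h]
        gcongr
        linarith
    _ = ∫⁻ _ in Ioc U V, ENNReal.ofReal (V ^ (β - 1)) *
          yInv Φ (ENNReal.ofReal (V ^ (lam - 1))) := by
        rw [setLIntegral_const, Real.volume_Ioc, ENNReal.ofReal_mul (by positivity)]
        ring
    _ ≤ _ := by
        refine setLIntegral_mono' measurableSet_Ioc fun s hs => ?_
        have hs0 : 0 < s := hU.trans hs.1
        have e : ENNReal.ofReal (s ^ β) * yInv Φ (ENNReal.ofReal (s ^ (lam - 1))) /
            ENNReal.ofReal s =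
            ENNReal.ofReal (s ^ (β - 1)) * yInv Φ (ENNReal.ofReal (s ^ (lam - 1))) := by
          rw [Real.rpow_sub_one hs0.ne' β, ENNReal.ofReal_div_of_pos hs0]
          simp only [div_eq_mul_inv]
          ring
        rw [e]
        have mono : ∀ p : ℝ, p ≤ 1 → V ^ (p - 1) ≤ s ^ (p - 1) := fun p hp =>
          Real.rpow_le_rpow_of_nonpos hs0 hs.2 (by linarith)
        exact mul_le_mul' (ENNReal.ofReal_le_ofReal (mono β hβ))
          (yInv_mono Φ (ENNReal.ofReal_le_ofReal (mono lam hlam)))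

lemma lintegral_annulus_le {n : ℕ} (hn : n ≠ 0) {α : ℝ} (hαn : α < n)
    {Φ : ℝ≥0∞ → ℝ≥0∞} (hΦ : IsOrliczFn Φ) {lam : ℝ} (hlam : lam < 1) {c : ℝ} (hc : 0 < c)
    (hvol : ∀ R : ℝ, 0 < R → volume (ball (0 : Eu n) R) = ENNReal.ofReal (c * R ^ n))
    (f : Eu n → ℝ) {r : ℝ} (hr : 0 < r) :
    ∫⁻ y in ball (0 : Eu n) (2 * r) \ ball 0 r,
        (‖f y‖₊ : ℝ≥0∞) * ENNReal.ofReal (‖y‖ ^ (α - n)) ≤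
      ENNReal.ofReal (4 * (2 : ℝ) ^ ((n : ℝ) - α) * c ^ (1 - α / n)) * centralNorm Φ lam f *
        ∫⁻ s in Ioc (c * r ^ n) (c * (2 * r) ^ n),
          ENNReal.ofReal (s ^ (α / n)) * yInv Φ (ENNReal.ofReal (s ^ (lam - 1))) /
            ENNReal.ofReal s := by
  have hnpos : (0 : ℝ) < n := by positivity
  set V : ℝ := c * (2 * r) ^ n with hV_def
  have hV : 0 < V := by positivity
  have hUV : 2 * (c * r ^ n) ≤ V := by
    have h2 : (2 : ℝ) ≤ 2 ^ n := le_self_pow₀ (by norm_num) hn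
    have : 0 < c * r ^ n := by positivity
    calc 2 * (c * r ^ n) ≤ 2 ^ n * (c * r ^ n) := by gcongr
      _ = V := by rw [hV_def, mul_pow]; ring
  have hconst : r ^ (α - n) * (2 * V) =
      4 * (2 : ℝ) ^ ((n : ℝ) - α) * c ^ (1 - α / n) * (V ^ (α / n) / 2) := by
    have h1 : V ^ (α / n) = c ^ (α / n) * (2 ^ α * r ^ α) := by
      rw [hV_def, Real.mul_rpow hc.le (by positivity), ← Real.rpow_natCast (2 * r) n,
        ← Real.rpow_mul (by positivity), mul_div_cancel₀ _ hnpos.ne',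
        Real.mul_rpow (by norm_num) hr.le]
    rw [h1, hV_def, Real.rpow_sub hr, Real.rpow_sub two_pos, Real.rpow_sub hc, Real.rpow_one,
      Real.rpow_natCast, Real.rpow_natCast, mul_pow]
    have := Real.rpow_pos_of_pos hc (α / n)
    have := Real.rpow_pos_of_pos (two_pos (α := ℝ)) α
    field_simp
    norm_num
  have hpt : ∀ y ∈ ball (0 : Eu n) (2 * r) \ ball 0 r,
      (‖f y‖₊ : ℝ≥0∞) * ENNReal.ofReal (‖y‖ ^ (α - n)) ≤
        (‖f y‖₊ : ℝ≥0∞) * ENNReal.ofReal (r ^ (α - n)) := by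
    intro y hy
    have hy' : r ≤ ‖y‖ := by simpa using hy.2
    exact mul_le_mul_right (ENNReal.ofReal_le_ofReal
      (Real.rpow_le_rpow_of_nonpos hr hy' (by linarith))) _
  have hnorm : orliczNorm Φ lam (ball (0 : Eu n) (2 * r)) f ≤ centralNorm Φ lam f :=
    le_iSup₂_of_le (2 * r) (by positivity) le_rfl
  calc ∫⁻ y in ball (0 : Eu n) (2 * r) \ ball 0 r,
        (‖f y‖₊ : ℝ≥0∞) * ENNReal.ofReal (‖y‖ ^ (α - n))
      ≤ ∫⁻ y in ball (0 : Eu n) (2 * r) \ ball 0 r,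
          (‖f y‖₊ : ℝ≥0∞) * ENNReal.ofReal (r ^ (α - n)) :=
        setLIntegral_mono' (measurableSet_ball.diff measurableSet_ball) hpt
    _ ≤ ∫⁻ y in ball (0 : Eu n) (2 * r), (‖f y‖₊ : ℝ≥0∞) * ENNReal.ofReal (r ^ (α - n)) :=
        lintegral_mono_set sdiff_subset
    _ = (∫⁻ y in ball (0 : Eu n) (2 * r), (‖f y‖₊ : ℝ≥0∞)) * ENNReal.ofReal (r ^ (α - n)) :=
        lintegral_mul_const' _ _ ENNReal.ofReal_ne_top
    _ ≤ centralNorm Φ lam f *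
          (2 * ENNReal.ofReal V * yInv Φ (ENNReal.ofReal (V ^ (lam - 1)))) *
          ENNReal.ofReal (r ^ (α - n)) := by
        gcongr
        exact (lintegral_nnnorm_le_orliczNorm hΦ lam f hV (hvol _ (by positivity))).trans
          (by gcongr)
    _ = ENNReal.ofReal (r ^ (α - n) * (2 * V)) * centralNorm Φ lam f *
          yInv Φ (ENNReal.ofReal (V ^ (lam - 1))) := by
        rw [ENNReal.ofReal_mul (p := r ^ (α - n)) (by positivity), ENNReal.ofReal_mul zero_le_two,
          ENNReal.ofReal_ofNat]
        ring
    _ = ENNReal.ofReal (4 * (2 : ℝ) ^ ((n : ℝ) - α) * c ^ (1 - α / n)) * centralNorm Φ lam f *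
          (ENNReal.ofReal (V ^ (α / n) / 2) * yInv Φ (ENNReal.ofReal (V ^ (lam - 1)))) := by
        rw [hconst, ENNReal.ofReal_mul (by positivity)]
        ring
    _ ≤ _ := by
        gcongr
        exact mul_yInv_le_lintegral_Ioc ((div_le_one hnpos).2 hαn.le) hlam.le (by positivity) hUV

/-- tail estimate for functions in central Morrey–Orlicz spaces. -/
theorem statement11 {n : ℕ} (α : ℝ) (hα : 0 < α) (hαn : α < n)
    (Φ : ℝ≥0∞ → ℝ≥0∞) (hΦ : IsOrliczFn Φ) (lam : ℝ) (hlam0 : 0 ≤ lam) (hlam1 : lam < 1) :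
    ∃ C₃ : ℝ, 0 < C₃ ∧ ∀ f : Eu n → ℝ, LocallyIntegrable f volume → centralNorm Φ lam f ≠ ∞ →
      ∀ r : ℝ, 0 < r →
        (∫⁻ y in (ball (0 : Eu n) r)ᶜ, (‖f y‖₊ : ℝ≥0∞) * ENNReal.ofReal (‖y‖ ^ (α - n))) ≤
          ENNReal.ofReal C₃ * centralNorm Φ lam f *
            ∫⁻ s in Ioi (volume (ball (0 : Eu n) r)).toReal,
              ENNReal.ofReal (s ^ (α / n)) * yInv Φ (ENNReal.ofReal (s ^ (lam - 1))) /
                ENNReal.ofReal s := by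
  have hnpos : (0 : ℝ) < n := hα.trans hαn
  have hn : n ≠ 0 := by
    rintro rfl
    simp at hnpos
  obtain ⟨c, hc, hvol⟩ := exists_volume_ball_eq n
  refine ⟨4 * (2 : ℝ) ^ ((n : ℝ) - α) * c ^ (1 - α / n), by positivity, ?_⟩
  intro f _ _ r hr
  set C : ℝ := 4 * (2 : ℝ) ^ ((n : ℝ) - α) * c ^ (1 - α / n)
  set F : ℝ → ℝ≥0∞ := fun s =>
    ENNReal.ofReal (s ^ (α / n)) * yInv Φ (ENNReal.ofReal (s ^ (lam - 1))) / ENNReal.ofReal s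
  let g : ℕ → ℝ := fun k => c * (2 ^ k * r) ^ n
  have hg : Monotone g := by
    intro i j hij
    have : (2 : ℝ) ^ i ≤ 2 ^ j := pow_le_pow_right₀ (by norm_num) hij
    simp only [g]
    gcongr
  have hr0 : (volume (ball (0 : Eu n) r)).toReal = g 0 := by
    rw [hvol r hr, ENNReal.toReal_ofReal (by positivity)]
    simp [g]
  calc ∫⁻ y in (ball (0 : Eu n) r)ᶜ, (‖f y‖₊ : ℝ≥0∞) * ENNReal.ofReal (‖y‖ ^ (α - n))
      ≤ ∫⁻ y in ⋃ k : ℕ, ball (0 : Eu n) (2 ^ (k + 1) * r) \ ball 0 (2 ^ k * r),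
          (‖f y‖₊ : ℝ≥0∞) * ENNReal.ofReal (‖y‖ ^ (α - n)) :=
        lintegral_mono_set (compl_ball_subset_iUnion_annuli hr)
    _ ≤ ∑' k : ℕ, ∫⁻ y in ball (0 : Eu n) (2 ^ (k + 1) * r) \ ball 0 (2 ^ k * r),
          (‖f y‖₊ : ℝ≥0∞) * ENNReal.ofReal (‖y‖ ^ (α - n)) := lintegral_iUnion_le _ _
    _ ≤ ∑' k : ℕ, ENNReal.ofReal C * centralNorm Φ lam f * ∫⁻ s in Ioc (g k) (g (k + 1)), F s := by
        refine ENNReal.tsum_le_tsum fun k => ?_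
        have h := lintegral_annulus_le hn hαn hΦ hlam1 hc hvol f
          (r := 2 ^ k * r) (by positivity)
        have e : 2 * ((2 : ℝ) ^ k * r) = 2 ^ (k + 1) * r := by ring
        rw [e] at h
        exact h
    _ = ENNReal.ofReal C * centralNorm Φ lam f * ∫⁻ s in ⋃ k, Ioc (g k) (g (k + 1)), F s := by
        rw [ENNReal.tsum_mul_left, lintegral_iUnion (s := fun k => Ioc (g k) (g (k + 1)))
          (fun _ => measurableSet_Ioc) hg.pairwise_disjoint_on_Ioc_succ]
    _ ≤ ENNReal.ofReal C * centralNorm Φ lam f *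
          ∫⁻ s in Ioi (volume (ball (0 : Eu n) r)).toReal, F s := by
        rw [hr0]
        gcongr
        exact iUnion_subset fun k s hs => (hg (Nat.zero_le k)).trans_lt hs.1
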